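/- Let γ° := ∑_{i∈I} ‖y_i − A_iᵀ x°‖². Suppose c̄ > 0, αn ≥ (n + d̄)/2 + γ°/c̄² for a positive integer d̄, and every subset of I of cardinality d̄ is nondegenerate. Let d_J be any integer with d̄ ≤ d_J ≤ (2α−1)·n − γ°/c̄². Then every TLS-optimal x_TLS, with I_TLS := {i ∈ {1,…,n} : ‖y_i − A_iᵀ x_TLS‖ ≤ c̄}, satisfies ( min over all J ⊆ I_TLS with |J| = d_J of σ_min(A_J) ) · ‖x_TLS − x°‖ ≤ 2·√(d_J)·c̄. -/

import Mathlib

open scoped BigOperators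

noncomputable section

/-- Euclidean norm of a finite real vector. -/
def enorm {d : ℕ} (v : Fin d → ℝ) : ℝ := Real.sqrt (∑ k, v k ^ 2)

/-- Residual `‖y_i − A_iᵀ x‖` of `x` at measurement `i`. -/
def resid {n dx dy : ℕ} (y : Fin n → Fin dy → ℝ)
    (A : Fin n → Matrix (Fin dx) (Fin dy) ℝ) (x : Fin dx → ℝ) (i : Fin n) : ℝ :=
  enorm fun j => y i j - ∑ k, A i k j * x k

/-- Feasibility for the (MC) problem. -/
def MCFeasible {n dx dy : ℕ} (y : Fin n → Fin dy → ℝ)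
    (A : Fin n → Matrix (Fin dx) (Fin dy) ℝ) (𝕏 : Set (Fin dx → ℝ)) (cbar : ℝ)
    (ω : Fin n → ℝ) (x : Fin dx → ℝ) : Prop :=
  (∀ i, ω i = 0 ∨ ω i = 1) ∧ x ∈ 𝕏 ∧ ∀ i, ω i * resid y A x i ^ 2 ≤ cbar ^ 2

/-- `(x, ω)` is an optimal solution of (MC). -/
def MCOptimal {n dx dy : ℕ} (y : Fin n → Fin dy → ℝ)
    (A : Fin n → Matrix (Fin dx) (Fin dy) ℝ) (𝕏 : Set (Fin dx → ℝ)) (cbar : ℝ)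
    (ω : Fin n → ℝ) (x : Fin dx → ℝ) : Prop :=
  MCFeasible y A 𝕏 cbar ω x ∧
    ∀ ω' x', MCFeasible y A 𝕏 cbar ω' x' → ∑ i, ω' i ≤ ∑ i, ω i

/-- The (TLS) objective. -/
def tlsObj {n dx dy : ℕ} (y : Fin n → Fin dy → ℝ)
    (A : Fin n → Matrix (Fin dx) (Fin dy) ℝ) (cbar : ℝ) (x : Fin dx → ℝ) : ℝ :=
  ∑ i, min (resid y A x i ^ 2) (cbar ^ 2)

/-- `x` is an optimal solution of (TLS). -/
def TLSOptimal {n dx dy : ℕ} (y : Fin n → Fin dy → ℝ)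
    (A : Fin n → Matrix (Fin dx) (Fin dy) ℝ) (𝕏 : Set (Fin dx → ℝ)) (cbar : ℝ)
    (x : Fin dx → ℝ) : Prop :=
  x ∈ 𝕏 ∧ ∀ x' ∈ 𝕏, tlsObj y A cbar x ≤ tlsObj y A cbar x'

/-- A set `J` of measurement indices is nondegenerate: the least-squares problem
over `J` admits a unique minimizer on `𝕏`. -/
def Nondegenerate {n dx dy : ℕ} (y : Fin n → Fin dy → ℝ)
    (A : Fin n → Matrix (Fin dx) (Fin dy) ℝ) (𝕏 : Set (Fin dx → ℝ))
    (J : Finset (Fin n)) : Prop :=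
  ∃! x, x ∈ 𝕏 ∧ ∀ x' ∈ 𝕏, ∑ i ∈ J, resid y A x i ^ 2 ≤ ∑ i ∈ J, resid y A x' i ^ 2

/-- Smallest singular value of the matrix stacking the blocks `A_iᵀ`, `i ∈ J`. -/
def sigmaMin {n dx dy : ℕ} (A : Fin n → Matrix (Fin dx) (Fin dy) ℝ)
    (J : Finset (Fin n)) : ℝ :=
  sInf { s | ∃ v : Fin dx → ℝ, _root_.enorm v = 1 ∧
    s = Real.sqrt (∑ i ∈ J, ∑ j, (∑ k, A i k j * v k) ^ 2) }

theorem enorm_nonneg {d : ℕ} (v : Fin d → ℝ) : 0 ≤ _root_.enorm v :=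
  Real.sqrt_nonneg _

theorem cast_card_compl_fin {n : ℕ} (I : Finset (Fin n)) : ((Iᶜ).card : ℝ) = n - I.card := by
  rw [eq_sub_iff_add_eq']
  exact_mod_cast (Finset.card_add_card_compl I).trans (Fintype.card_fin n)

theorem resid_sq {n dx dy : ℕ} (y : Fin n → Fin dy → ℝ)
    (A : Fin n → Matrix (Fin dx) (Fin dy) ℝ) (x : Fin dx → ℝ) (i : Fin n) :
    resid y A x i ^ 2 = ∑ j, (y i j - ∑ k, A i k j * x k) ^ 2 :=
  Real.sq_sqrt (Finset.sum_nonneg fun _ _ => sq_nonneg _)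

theorem resid_nonneg {n dx dy : ℕ} (y : Fin n → Fin dy → ℝ)
    (A : Fin n → Matrix (Fin dx) (Fin dy) ℝ) (x : Fin dx → ℝ) (i : Fin n) :
    0 ≤ resid y A x i :=
  Real.sqrt_nonneg _

theorem sum_sq_apply_sub_le {n dx dy : ℕ} (y : Fin n → Fin dy → ℝ)
    (A : Fin n → Matrix (Fin dx) (Fin dy) ℝ) (x x' : Fin dx → ℝ) (i : Fin n) :
    ∑ j, (∑ k, A i k j * (x - x') k) ^ 2 ≤
      2 * resid y A x i ^ 2 + 2 * resid y A x' i ^ 2 := by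
  rw [resid_sq, resid_sq, Finset.mul_sum, Finset.mul_sum, ← Finset.sum_add_distrib]
  refine Finset.sum_le_sum fun j _ => ?_
  have h : ∑ k, A i k j * (x - x') k = ∑ k, A i k j * x k - ∑ k, A i k j * x' k := by
    simp [mul_sub]
  rw [h]
  nlinarith [sq_nonneg ((y i j - ∑ k, A i k j * x k) + (y i j - ∑ k, A i k j * x' k))]

theorem sigmaMin_nonneg {n dx dy : ℕ} (A : Fin n → Matrix (Fin dx) (Fin dy) ℝ)
    (J : Finset (Fin n)) : 0 ≤ sigmaMin A J := by
  refine Real.sInf_nonneg ?_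
  rintro s ⟨v, -, rfl⟩
  exact Real.sqrt_nonneg _

theorem enorm_smul_of_nonneg {d : ℕ} {t : ℝ} (ht : 0 ≤ t) (v : Fin d → ℝ) :
    _root_.enorm (t • v) = t * _root_.enorm v := by
  simp only [_root_.enorm, Pi.smul_apply, smul_eq_mul, mul_pow, ← Finset.mul_sum]
  rw [Real.sqrt_mul (sq_nonneg t), Real.sqrt_sq ht]

theorem sigmaMin_mul_enorm_le {n dx dy : ℕ} (A : Fin n → Matrix (Fin dx) (Fin dy) ℝ)
    (J : Finset (Fin n)) (v : Fin dx → ℝ) :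
    sigmaMin A J * _root_.enorm v ≤
      Real.sqrt (∑ i ∈ J, ∑ j, (∑ k, A i k j * v k) ^ 2) := by
  rcases (enorm_nonneg v).eq_or_lt with hv | hv
  · rw [← hv, mul_zero]
    exact Real.sqrt_nonneg _
  have ht : 0 ≤ (_root_.enorm v)⁻¹ := inv_nonneg.2 hv.le
  have hle : sigmaMin A J ≤
      Real.sqrt (∑ i ∈ J, ∑ j, (∑ k, A i k j * ((_root_.enorm v)⁻¹ • v) k) ^ 2) := by
    refine csInf_le ⟨0, ?_⟩ ⟨(_root_.enorm v)⁻¹ • v, ?_, rfl⟩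
    · rintro s ⟨w, -, rfl⟩
      exact Real.sqrt_nonneg _
    · rw [enorm_smul_of_nonneg ht, inv_mul_cancel₀ hv.ne']
  have hscale : ∑ i ∈ J, ∑ j, (∑ k, A i k j * ((_root_.enorm v)⁻¹ • v) k) ^ 2 =
      ((_root_.enorm v)⁻¹) ^ 2 * ∑ i ∈ J, ∑ j, (∑ k, A i k j * v k) ^ 2 := by
    simp only [Finset.mul_sum, Pi.smul_apply, smul_eq_mul, ← mul_pow]
    simp only [mul_left_comm]
  rw [hscale, Real.sqrt_mul (sq_nonneg _), Real.sqrt_sq ht] at hle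
  calc sigmaMin A J * _root_.enorm v
      ≤ ((_root_.enorm v)⁻¹ * Real.sqrt (∑ i ∈ J, ∑ j, (∑ k, A i k j * v k) ^ 2)) *
          _root_.enorm v := mul_le_mul_of_nonneg_right hle hv.le
    _ = _ := by field_simp

theorem sigmaMin_mul_enorm_sub_le {n dx dy : ℕ} (y : Fin n → Fin dy → ℝ)
    (A : Fin n → Matrix (Fin dx) (Fin dy) ℝ) {c : ℝ} (hc : 0 ≤ c) {x x' : Fin dx → ℝ}
    {J : Finset (Fin n)} (hx : ∀ i ∈ J, resid y A x i ≤ c)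
    (hx' : ∀ i ∈ J, resid y A x' i ≤ c) :
    sigmaMin A J * _root_.enorm (x - x') ≤ 2 * Real.sqrt J.card * c := by
  refine (sigmaMin_mul_enorm_le A J _).trans (Real.sqrt_le_iff.2 ⟨by positivity, ?_⟩)
  rw [mul_pow, mul_pow, Real.sq_sqrt (Nat.cast_nonneg _)]
  calc ∑ i ∈ J, ∑ j, (∑ k, A i k j * (x - x') k) ^ 2
      ≤ ∑ i ∈ J, 4 * c ^ 2 := Finset.sum_le_sum fun i hi => by
        have h := pow_le_pow_left₀ (resid_nonneg y A x i) (hx i hi) 2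
        have h' := pow_le_pow_left₀ (resid_nonneg y A x' i) (hx' i hi) 2
        linarith [sum_sq_apply_sub_le y A x x' i]
    _ = _ := by rw [Finset.sum_const, nsmul_eq_mul]; ring

theorem tlsObj_le {n dx dy : ℕ} (y : Fin n → Fin dy → ℝ)
    (A : Fin n → Matrix (Fin dx) (Fin dy) ℝ) (c : ℝ) (x : Fin dx → ℝ) (I : Finset (Fin n)) :
    tlsObj y A c x ≤ ∑ i ∈ I, resid y A x i ^ 2 + (n - I.card) * c ^ 2 := by
  rw [tlsObj, ← Finset.sum_add_sum_compl I, ← cast_card_compl_fin, ← nsmul_eq_mul, ← Finset.sum_const]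
  exact add_le_add (Finset.sum_le_sum fun _ _ => min_le_left _ _)
    (Finset.sum_le_sum fun _ _ => min_le_right _ _)

theorem le_tlsObj {n dx dy : ℕ} (y : Fin n → Fin dy → ℝ)
    (A : Fin n → Matrix (Fin dx) (Fin dy) ℝ) {c : ℝ} (hc : 0 ≤ c) (x : Fin dx → ℝ)
    {K : Finset (Fin n)} (hK : ∀ i ∉ K, c ≤ resid y A x i) :
    (n - K.card) * c ^ 2 ≤ tlsObj y A c x := by
  rw [tlsObj, ← Finset.sum_add_sum_compl K, ← cast_card_compl_fin, ← nsmul_eq_mul, ← Finset.sum_const]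
  refine le_add_of_nonneg_of_le
    (Finset.sum_nonneg fun _ _ => le_min (sq_nonneg _) (sq_nonneg _))
    (Finset.sum_le_sum fun i hi => le_min ?_ le_rfl)
  exact pow_le_pow_left₀ hc (hK i (Finset.mem_compl.1 hi)) 2

/-- A posteriori estimation contract for (TLS) (Proposition 2, noisy bound). -/
theorem tls_a_posteriori_contract
    {n dx dy : ℕ} (hn : 0 < n) (hdx : 0 < dx) (hdy : 0 < dy)
    (y : Fin n → Fin dy → ℝ) (A : Fin n → Matrix (Fin dx) (Fin dy) ℝ)
    (𝕏 : Set (Fin dx → ℝ)) (x0 : Fin dx → ℝ) (hx0 : x0 ∈ 𝕏)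
    (cbar : ℝ) (hcbar : 0 < cbar)
    (α : ℝ) (hα0 : 0 < α) (hα1 : α ≤ 1)
    (I : Finset (Fin n)) (hIcard : (I.card : ℝ) = α * n)
    (hinlier : ∀ i ∈ I, resid y A x0 i ≤ cbar)
    (γ0 : ℝ) (hγ0 : γ0 = ∑ i ∈ I, resid y A x0 i ^ 2)
    (dbar : ℕ) (hdbar : 0 < dbar)
    (hsize : ((n : ℝ) + dbar) / 2 + γ0 / cbar ^ 2 ≤ α * n)
    (hnondeg : ∀ J ⊆ I, J.card = dbar → Nondegenerate y A 𝕏 J)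
    (dJ : ℕ) (hdJlo : dbar ≤ dJ)
    (hdJhi : (dJ : ℝ) ≤ (2 * α - 1) * n - γ0 / cbar ^ 2)
    (xTLS : Fin dx → ℝ) (hopt : TLSOptimal y A 𝕏 cbar xTLS) :
    sInf { s | ∃ J : Finset (Fin n),
        (∀ i ∈ J, resid y A xTLS i ≤ cbar) ∧ J.card = dJ ∧ s = sigmaMin A J } *
      _root_.enorm (xTLS - x0) ≤ 2 * Real.sqrt dJ * cbar := by
  classical
  set K : Finset (Fin n) := Finset.univ.filter fun i => resid y A xTLS i ≤ cbar with hK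
  have hc2 : 0 < cbar ^ 2 := by positivity
  have hobj : ((n : ℝ) - K.card) * cbar ^ 2 ≤ γ0 + (n - I.card) * cbar ^ 2 := by
    rw [hγ0]
    refine (le_tlsObj y A hcbar.le xTLS fun i hi => ?_).trans
      ((hopt.2 x0 hx0).trans (tlsObj_le y A cbar x0 I))
    simp only [hK, Finset.mem_filter, Finset.mem_univ, true_and, not_le] at hi
    exact hi.le
  have hKcard : (I.card : ℝ) - K.card ≤ γ0 / cbar ^ 2 := by
    rw [le_div_iff₀ hc2]
    linarith
  have hunion : ((K ∪ I).card : ℝ) + ((K ∩ I).card : ℝ) = K.card + I.card := by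
    exact_mod_cast Finset.card_union_add_card_inter K I
  have hunion_le : ((K ∪ I).card : ℝ) ≤ n := by
    exact_mod_cast card_finset_fin_le (K ∪ I)
  have hdJ : dJ ≤ (K ∩ I).card := by
    have : (dJ : ℝ) ≤ ((K ∩ I).card : ℝ) := by linarith
    exact_mod_cast this
  obtain ⟨J, hJ, rfl⟩ := Finset.exists_subset_card_eq hdJ
  have hJK : ∀ i ∈ J, resid y A xTLS i ≤ cbar := fun i hi =>
    (Finset.mem_filter.1 (Finset.mem_inter.1 (hJ hi)).1).2
  have hJI : ∀ i ∈ J, resid y A x0 i ≤ cbar := fun i hi =>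
    hinlier i (Finset.mem_inter.1 (hJ hi)).2
  refine le_trans (mul_le_mul_of_nonneg_right ?_ (enorm_nonneg _))
    (sigmaMin_mul_enorm_sub_le y A hcbar.le hJK hJI)
  refine csInf_le ⟨0, ?_⟩ ⟨J, hJK, rfl, rfl⟩
  rintro s ⟨J', -, -, rfl⟩
  exact sigmaMin_nonneg A J'
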